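/- Let n ≥ 2. For every real symmetric n×n matrix ξ one has (1/(2n))|ξ|² ≤ j̄(ξ) ≤ ½|ξ|², where j̄(ξ) := sup{ ξ:τ − ½|τ|² : τ real symmetric n×n with det τ = 0 }. -/

import Mathlib

open Matrix Polynomial
open scoped BigOperators

/-- Squared Frobenius norm of a matrix. -/
noncomputable def frobSq {n : ℕ} (ξ : Matrix (Fin n) (Fin n) ℝ) : ℝ :=
  ∑ i, ∑ j, (ξ i j) ^ 2

/-- Frobenius inner product ξ:τ = tr(ξτ) of symmetric matrices. -/
noncomputable def frobInner {n : ℕ} (ξ τ : Matrix (Fin n) (Fin n) ℝ) : ℝ :=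
  Matrix.trace (ξ * τ)

/-- j̄(ξ) = sup over singular symmetric τ of (ξ:τ − ½|τ|²). -/
noncomputable def jbar {n : ℕ} (ξ : Matrix (Fin n) (Fin n) ℝ) : ℝ :=
  sSup {v : ℝ | ∃ τ : Matrix (Fin n) (Fin n) ℝ,
    τ.IsSymm ∧ τ.det = 0 ∧ v = frobInner ξ τ - frobSq τ / 2}

theorem frobInner_eq_sum {n : ℕ} (ξ : Matrix (Fin n) (Fin n) ℝ) {τ : Matrix (Fin n) (Fin n) ℝ}
    (hτ : τ.IsSymm) : frobInner ξ τ = ∑ i, ∑ j, ξ i j * τ i j := by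
  simp only [frobInner, Matrix.trace, Matrix.diag_apply, Matrix.mul_apply]
  exact Finset.sum_congr rfl fun i _ => Finset.sum_congr rfl fun j _ => by rw [hτ.apply i j]

theorem frobSq_eq_frobInner {n : ℕ} {τ : Matrix (Fin n) (Fin n) ℝ} (hτ : τ.IsSymm) :
    frobSq τ = frobInner τ τ := by
  simp only [frobInner_eq_sum τ hτ, frobSq, sq]

theorem frobInner_sub_half_frobSq_le {n : ℕ} (ξ : Matrix (Fin n) (Fin n) ℝ)
    {τ : Matrix (Fin n) (Fin n) ℝ} (hτ : τ.IsSymm) :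
    frobInner ξ τ - frobSq τ / 2 ≤ frobSq ξ / 2 := by
  have h : frobInner ξ τ ≤ ∑ i, ∑ j, (ξ i j ^ 2 / 2 + τ i j ^ 2 / 2) := by
    rw [frobInner_eq_sum ξ hτ]
    gcongr with i _ j _
    linarith [two_mul_le_add_sq (ξ i j) (τ i j)]
  simp only [Finset.sum_add_distrib, ← Finset.sum_div] at h
  unfold frobSq
  linarith

theorem frobSq_eq_sum_eigenvalues_sq {n : ℕ} {ξ : Matrix (Fin n) (Fin n) ℝ}
    (hξ : ξ.IsHermitian) : frobSq ξ = ∑ i, hξ.eigenvalues i ^ 2 := by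
  rw [frobSq_eq_frobInner (by simpa [Matrix.IsSymm] using hξ.eq), frobInner]
  conv_lhs => rw [hξ.spectral_theorem, ← map_mul, Unitary.conjStarAlgAut_apply,
    Matrix.trace_mul_comm, ← mul_assoc]
  simp [Matrix.trace, sq]

/-- An eigenvalue of largest modulus yields a rank-one competitor. -/
theorem exists_frobSq_div_le {n : ℕ} (hn : 2 ≤ n) {ξ : Matrix (Fin n) (Fin n) ℝ}
    (hξ : ξ.IsHermitian) :
    ∃ τ : Matrix (Fin n) (Fin n) ℝ, τ.IsSymm ∧ τ.det = 0 ∧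
      frobSq ξ / (2 * n) ≤ frobInner ξ τ - frobSq τ / 2 := by
  have : Nontrivial (Fin n) := Fin.nontrivial_iff_two_le.mpr hn
  have hn0 : (0 : ℝ) < n := by positivity
  obtain ⟨i, -, hi⟩ : ∃ i ∈ Finset.univ, frobSq ξ / n ≤ hξ.eigenvalues i ^ 2 := by
    apply Finset.exists_le_of_sum_le Finset.univ_nonempty
    rw [← frobSq_eq_sum_eigenvalues_sq hξ]
    simp [mul_div_cancel₀ _ hn0.ne']
  set l := hξ.eigenvalues i
  set v : Fin n → ℝ := ⇑(hξ.eigenvectorBasis i)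
  have hv : v ⬝ᵥ v = 1 := by
    have h := hξ.eigenvectorBasis.inner_eq_one i
    rwa [EuclideanSpace.inner_eq_star_dotProduct, star_trivial] at h
  have hmul : ξ *ᵥ v = l • v := hξ.mulVec_eigenvectorBasis i
  have hsymm : (l • vecMulVec v v).IsSymm := by
    simp [Matrix.IsSymm, Matrix.transpose_smul, Matrix.transpose_vecMulVec]
  refine ⟨l • vecMulVec v v, hsymm, by simp [Matrix.det_vecMulVec], ?_⟩
  have hinner : frobInner ξ (l • vecMulVec v v) = l ^ 2 := by
    simp [frobInner, Matrix.mul_vecMulVec, hmul, Matrix.trace_vecMulVec, hv, sq]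
  have hsq : frobSq (l • vecMulVec v v) = l ^ 2 := by
    rw [frobSq_eq_frobInner hsymm]
    simp [frobInner, Matrix.vecMulVec_mul_vecMulVec, Matrix.trace_vecMulVec, hv, sq]
  rw [hinner, hsq, mul_comm, ← div_div]
  linarith

theorem jbar_bounds (n : ℕ) (hn : 2 ≤ n)
    (ξ : Matrix (Fin n) (Fin n) ℝ) (hξ : ξ.IsSymm) :
    frobSq ξ / (2 * n) ≤ jbar ξ ∧ jbar ξ ≤ frobSq ξ / 2 := by
  have hle : ∀ w ∈ {v : ℝ | ∃ τ : Matrix (Fin n) (Fin n) ℝ,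
      τ.IsSymm ∧ τ.det = 0 ∧ v = frobInner ξ τ - frobSq τ / 2}, w ≤ frobSq ξ / 2 := by
    rintro _ ⟨τ, hτ, -, rfl⟩
    exact frobInner_sub_half_frobSq_le ξ hτ
  obtain ⟨τ, hτ, hdet, hval⟩ :=
    exists_frobSq_div_le hn (Matrix.isHermitian_iff_isSymm.mpr hξ)
  exact ⟨hval.trans (le_csSup ⟨_, hle⟩ ⟨τ, hτ, hdet, rfl⟩),
    csSup_le ⟨_, τ, hτ, hdet, rfl⟩ hle⟩
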